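/- arXiv:2111.14012 — 8 statements merged into one kernel-verified Lean document; each statement's English description precedes it below -/
import Mathlib

section
/- Let n ≥ 2 and c : {1,…,n} → {0,1}. For 0 ≤ t ≤ n, set n₁ = #{i : c(i) = 1}, n₂ = n − n₁, t₁ = #{i ≤ t : c(i) = 1} and t₂ = #{i ≤ t : c(i) = 0}. Then C(n,2) · R(t) = (n₁ − t₁ + t₂)(n₂ − t₂ + t₁). -/
/-- The number of pairs `1 ≤ i < j ≤ n` on which the clustering `c` and the
pseudo-clustering `δ_t` (with `δ_t(i) = 1` iff `i ≤ t`) disagree, i.e. exactly one of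
`c(i) = c(j)` and `δ_t(i) = δ_t(j)` holds. -/
def randCount (n : ℕ) (c : ℕ → Bool) (t : ℕ) : ℕ :=
  ((Finset.Icc 1 n ×ˢ Finset.Icc 1 n).filter
    (fun p => p.1 < p.2 ∧ ¬((c p.1 = c p.2) ↔ (p.1 ≤ t ↔ p.2 ≤ t)))).card

/-- The Rand index `R(t)` between the clustering `c` and `δ_t`:
the disagreement count divided by `C(n,2)`. -/
noncomputable def randIndex (n : ℕ) (c : ℕ → Bool) (t : ℕ) : ℝ :=
  (randCount n c t : ℝ) / (n.choose 2 : ℝ)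

/-- In a linear order, the increasing pairs of `s` separated by a predicate `P` are counted by the
product of the sizes of the two classes of `P`. -/
theorem card_filter_lt_and_not_iff {α : Type*} [LinearOrder α] (s : Finset α) (P : α → Prop)
    [DecidablePred P] :
    ((s ×ˢ s).filter (fun p => p.1 < p.2 ∧ ¬(P p.1 ↔ P p.2))).card =
      (s.filter P).card * (s.filter (fun i => ¬P i)).card := by
  rw [← Finset.card_product]
  refine Finset.card_nbij' (fun p => if P p.1 then p else p.swap)
    (fun p => if p.1 < p.2 then p else p.swap) ?_ ?_ ?_ ?_
  all_goals
    rintro ⟨a, b⟩ h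
    simp only [Finset.coe_filter, Finset.coe_product, Set.mem_prod, Set.mem_ofPred_eq,
      Finset.mem_product, Prod.swap] at h ⊢
    grind

/-- Splitting the count of a predicate on `{1, …, n}` at `t ≤ n`. -/
theorem card_filter_Icc_split {t n : ℕ} (ht : t ≤ n) (P : ℕ → Prop) [DecidablePred P] :
    ((Finset.Icc 1 n).filter P).card =
      ((Finset.Icc 1 t).filter P).card + ((Finset.Ioc t n).filter P).card := by
  rw [← Finset.card_union_of_disjoint]
  · congr 1
    ext i
    simp only [Finset.mem_filter, Finset.mem_union, Finset.mem_Icc, Finset.mem_Ioc]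
    grind
  · rw [Finset.disjoint_left]
    simp only [Finset.mem_filter, Finset.mem_Icc, Finset.mem_Ioc]
    grind

theorem randCount_eq_mul (n : ℕ) (c : ℕ → Bool) (t : ℕ) :
    randCount n c t =
      ((Finset.Icc 1 n).filter (fun i => ¬(c i = true ↔ i ≤ t))).card *
        ((Finset.Icc 1 n).filter (fun i => ¬¬(c i = true ↔ i ≤ t))).card := by
  rw [← card_filter_lt_and_not_iff, randCount]
  congr 1
  ext p
  simp only [Finset.mem_filter]
  grind

/-- The number of indices on which `c` and `δ_t` differ is `n₁ - t₁ + t₂`. -/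
theorem card_filter_label_ne_add {t n : ℕ} (ht : t ≤ n) (c : ℕ → Bool) :
    ((Finset.Icc 1 n).filter (fun i => ¬(c i = true ↔ i ≤ t))).card +
        ((Finset.Icc 1 t).filter (fun i => c i = true)).card =
      ((Finset.Icc 1 n).filter (fun i => c i = true)).card +
        ((Finset.Icc 1 t).filter (fun i => c i = false)).card := by
  have h₁ : (Finset.Icc 1 t).filter (fun i => ¬(c i = true ↔ i ≤ t)) =
      (Finset.Icc 1 t).filter (fun i => c i = false) :=
    Finset.filter_congr fun i hi => by grind
  have h₂ : (Finset.Ioc t n).filter (fun i => ¬(c i = true ↔ i ≤ t)) =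
      (Finset.Ioc t n).filter (fun i => c i = true) :=
    Finset.filter_congr fun i hi => by grind
  rw [card_filter_Icc_split ht (fun i => ¬(c i = true ↔ i ≤ t)),
    card_filter_Icc_split ht (fun i => c i = true), h₁, h₂]
  omega

/-- **Rand index product formula.** With `n₁` the number of labels equal to `1`,
`n₂ = n − n₁`, and `t₁, t₂` the numbers of indices `i ≤ t` with `c(i) = 1` resp.
`c(i) = 0`, one has `C(n,2)·R(t) = (n₁ − t₁ + t₂)(n₂ − t₂ + t₁)`. -/
theorem stmt_4 (n : ℕ) (hn : 2 ≤ n) (c : ℕ → Bool) (t : ℕ) (ht : t ≤ n)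
    (n₁ n₂ t₁ t₂ : ℕ)
    (hn₁ : n₁ = ((Finset.Icc 1 n).filter (fun i => c i = true)).card)
    (hn₂ : n₂ = n - n₁)
    (ht₁ : t₁ = ((Finset.Icc 1 t).filter (fun i => c i = true)).card)
    (ht₂ : t₂ = ((Finset.Icc 1 t).filter (fun i => c i = false)).card) :
    (n.choose 2 : ℝ) * randIndex n c t =
      ((n₁ : ℝ) - (t₁ : ℝ) + (t₂ : ℝ)) * ((n₂ : ℝ) - (t₂ : ℝ) + (t₁ : ℝ)) := by
  have hchoose : (n.choose 2 : ℝ) ≠ 0 := by exact_mod_cast (Nat.choose_pos hn).ne'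
  rw [randIndex, mul_div_cancel₀ _ hchoose, randCount_eq_mul]
  have hne := card_filter_label_ne_add ht c
  have htotal := Finset.card_filter_add_card_filter_not (s := Finset.Icc 1 n)
    (fun i => ¬(c i = true ↔ i ≤ t))
  have hle := Finset.card_filter_le (Finset.Icc 1 n) (fun i => c i = true)
  rw [Nat.card_Icc, Nat.add_sub_cancel] at htotal hle
  rw [← hn₁, ← ht₁, ← ht₂] at hne
  rw [← hn₁] at hle
  have hsum : n₁ + n₂ = n := by omega
  push_cast
  have hneR := congrArg (Nat.cast : ℕ → ℝ) hne
  have htotalR := congrArg (Nat.cast : ℕ → ℝ) (htotal.trans hsum.symm)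
  push_cast at hneR htotalR
  congr 1 <;> linarith
end

section
/- Let n ≥ 2, let c : {1,…,n} → {0,1}, and extend the Rand index R(t) to all t ∈ {0,1,…,n}. If 1 ≤ t₀ ≤ n−1 and c(t₀) = c(t₀+1), then C(n,2) · ( 2R(t₀) − R(t₀−1) − R(t₀+1) ) = 2. -/
theorem randCount_eq_sum (n : ℕ) (c : ℕ → Bool) (t : ℕ) :
    (randCount n c t : ℤ) = ∑ i ∈ Finset.Icc 1 n, ∑ j ∈ Finset.Icc 1 n,
      if i < j ∧ ¬((c i = c j) ↔ (i ≤ t ↔ j ≤ t)) then 1 else 0 := by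
  rw [randCount, Finset.card_filter, Finset.sum_product]
  push_cast
  rfl

/-- The second difference at `t + 1` of the contribution of a single pair `(i, j)`. Only pairs
meeting `{t + 1, t + 2}` contribute, and apart from the pair `(t + 1, t + 2)` itself the
contributions of `t + 1` and of `t + 2` are opposite. -/
theorem pair_second_difference (c : ℕ → Bool) (t i j : ℕ) (hc : c (t + 1) = c (t + 2)) :
    2 * (if i < j ∧ ¬((c i = c j) ↔ (i ≤ t + 1 ↔ j ≤ t + 1)) then (1 : ℤ) else 0)
      - (if i < j ∧ ¬((c i = c j) ↔ (i ≤ t ↔ j ≤ t)) then 1 else 0)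
      - (if i < j ∧ ¬((c i = c j) ↔ (i ≤ t + 2 ↔ j ≤ t + 2)) then 1 else 0)
    = (if i = t + 1 then if j = t + 2 then 2 else 0 else 0)
      + (if j = t + 1 then if i < t + 1 then if c i = c (t + 1) then -1 else 1 else 0 else 0)
      - (if j = t + 2 then if i < t + 1 then if c i = c (t + 1) then -1 else 1 else 0 else 0)
      + (if i = t + 1 then if t + 2 < j then if c j = c (t + 1) then 1 else -1 else 0 else 0)
      - (if i = t + 2 then if t + 2 < j then if c j = c (t + 1) then 1 else -1 else 0 else 0) := by
  have hi : i < t + 1 ∨ i = t + 1 ∨ i = t + 2 ∨ t + 2 < i := by omega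
  have hj : j < t + 1 ∨ j = t + 1 ∨ j = t + 2 ∨ t + 2 < j := by omega
  rcases hi with hi | rfl | rfl | hi <;> rcases hj with hj | rfl | rfl | hj <;>
    grind (splits := 20)

theorem randCount_second_difference (n : ℕ) (c : ℕ → Bool) (t : ℕ) (ht : t + 2 ≤ n)
    (hc : c (t + 1) = c (t + 2)) :
    2 * (randCount n c (t + 1) : ℤ) - randCount n c t - randCount n c (t + 2) = 2 := by
  have h₁ : t + 1 ∈ Finset.Icc 1 n := Finset.mem_Icc.2 ⟨by omega, by omega⟩
  have h₂ : t + 2 ∈ Finset.Icc 1 n := Finset.mem_Icc.2 ⟨by omega, ht⟩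
  simp only [randCount_eq_sum, Finset.mul_sum, ← Finset.sum_sub_distrib]
  simp only [pair_second_difference c t _ _ hc, Finset.sum_add_distrib, Finset.sum_sub_distrib]
  have row (a : ℕ) (ha : a ∈ Finset.Icc 1 n) (f : ℕ → ℤ) :
      ∑ i ∈ Finset.Icc 1 n, ∑ j ∈ Finset.Icc 1 n, (if i = a then f j else 0)
        = ∑ j ∈ Finset.Icc 1 n, f j := by
    rw [Finset.sum_comm]
    simp only [Finset.sum_ite_eq', if_pos ha]
  rw [row _ h₁, row _ h₁, row _ h₂]
  simp only [Finset.sum_ite_eq', if_pos h₁, if_pos h₂]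
  ring

/-- **Strict discrete concavity of the Rand index at a non-boundary point.**
If `c(t₀) = c(t₀+1)` then `C(n,2)·(2R(t₀) − R(t₀−1) − R(t₀+1)) = 2`. -/
theorem stmt_5 (n : ℕ) (hn : 2 ≤ n) (c : ℕ → Bool) (t₀ : ℕ)
    (ht₀1 : 1 ≤ t₀) (ht₀n : t₀ ≤ n - 1) (hc : c t₀ = c (t₀ + 1)) :
    (n.choose 2 : ℝ) *
        (2 * randIndex n c t₀ - randIndex n c (t₀ - 1) - randIndex n c (t₀ + 1)) = 2 := by
  obtain ⟨t, rfl⟩ := Nat.exists_eq_add_of_le' ht₀1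
  have hpos : (n.choose 2 : ℝ) ≠ 0 := by exact_mod_cast (Nat.choose_pos hn).ne'
  have key : 2 * (randCount n c (t + 1) : ℝ) - randCount n c t - randCount n c (t + 2) = 2 := by
    exact_mod_cast randCount_second_difference n c t (by omega) hc
  simp only [randIndex, Nat.add_sub_cancel]
  field_simp
  exact key
end

section
/- Let n ≥ 2 and 1 ≤ τ ≤ n−1, and for each dimension d let X_1(d),…,X_n(d) be random vectors in ℝ^d (on a probability space depending on d) such that, as d → ∞: (a) d^{-1}‖X_i(d) − X_j(d)‖² → θ₁ in probability for i < j ≤ τ; (b) d^{-1}‖X_i(d) − X_j(d)‖² → θ₂ in probability for τ < i < j; (c) d^{-1}‖X_i(d) − X_j(d)‖² → θ₃ in probability for i ≤ τ < j. If θ₃ > max(θ₁, θ₂), then P( λ₀(S_τ) < λ₀(S) for every nonempty proper subset S of {1,…,n} with S ∉ {S_τ, S_τᶜ} ) → 1 as d → ∞; consequently, with probability tending to one, any minimizer S₀ of λ₀ satisfies S₀ = S_τ or S₀ = S_τᶜ. -/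
open MeasureTheory Filter

/-- The two-cluster within-group criterion
`λ₀(S) = (2|S|)⁻¹ Σ_{i,i' ∈ S} ‖X_i − X_{i'}‖² + (2|Sᶜ|)⁻¹ Σ_{j,j' ∈ Sᶜ} ‖X_j − X_{j'}‖²`. -/
noncomputable def lambda0 {E : Type*} [NormedAddCommGroup E] {n : ℕ}
    (X : Fin n → E) (S : Finset (Fin n)) : ℝ :=
  (2 * (S.card : ℝ))⁻¹ * ∑ i ∈ S, ∑ j ∈ S, ‖X i - X j‖ ^ 2
    + (2 * ((Sᶜ).card : ℝ))⁻¹ * ∑ i ∈ Sᶜ, ∑ j ∈ Sᶜ, ‖X i - X j‖ ^ 2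

/-- The subset `S_τ = {1, …, τ}` of indices (0-based: `{i : (i : ℕ) < τ}`). -/
def sTau (n τ : ℕ) : Finset (Fin n) := Finset.univ.filter (fun i => (i : ℕ) < τ)

/-- The two-cluster within-group criterion of a dissimilarity matrix `D`, evaluated at `S`. -/
noncomputable def withinCriterion {ι : Type*} [Fintype ι] [DecidableEq ι]
    (D : ι → ι → ℝ) (S : Finset ι) : ℝ :=
  (2 * (S.card : ℝ))⁻¹ * ∑ i ∈ S, ∑ j ∈ S, D i j
    + (2 * ((Sᶜ).card : ℝ))⁻¹ * ∑ i ∈ Sᶜ, ∑ j ∈ Sᶜ, D i j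

lemma continuous_withinCriterion {ι : Type*} [Fintype ι] [DecidableEq ι] (S : Finset ι) :
    Continuous fun D : ι → ι → ℝ => withinCriterion D S := by
  unfold withinCriterion
  fun_prop

lemma lambda0_eq_mul_withinCriterion {E : Type*} [NormedAddCommGroup E] {n : ℕ}
    (X : Fin n → E) (S : Finset (Fin n)) {c : ℝ} (hc : c ≠ 0) :
    lambda0 X S = c * withinCriterion (fun i j => ‖X i - X j‖ ^ 2 / c) S := by
  simp only [lambda0, withinCriterion, ← Finset.sum_div]
  field_simp

/-- The two-block dissimilarity matrix: zero on the diagonal, `θ₁` within `T`, `θ₂` within the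
complement of `T`, and `θ₃` across. -/
noncomputable def blockDissim {ι : Type*} [DecidableEq ι] (T : Finset ι) (θ₁ θ₂ θ₃ : ℝ)
    (i j : ι) : ℝ :=
  if i = j then 0 else
    if i ∈ T then (if j ∈ T then θ₁ else θ₃) else (if j ∈ T then θ₃ else θ₂)

lemma blockDissim_comm {ι : Type*} [DecidableEq ι] (T : Finset ι) (θ₁ θ₂ θ₃ : ℝ) (i j : ι) :
    blockDissim T θ₁ θ₂ θ₃ i j = blockDissim T θ₁ θ₂ θ₃ j i := by
  unfold blockDissim
  grind

lemma sum_blockDissim {ι : Type*} [Fintype ι] [DecidableEq ι] (T S : Finset ι)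
    (θ₁ θ₂ θ₃ : ℝ) :
    ∑ i ∈ S, ∑ j ∈ S, blockDissim T θ₁ θ₂ θ₃ i j =
      θ₁ * ((S ∩ T).card * ((S ∩ T).card - 1)) + θ₂ * ((S ∩ Tᶜ).card * ((S ∩ Tᶜ).card - 1))
        + 2 * θ₃ * ((S ∩ T).card * (S ∩ Tᶜ).card) := by
  set u : ι → ℝ := fun i => if i ∈ T then 1 else 0 with hu
  set v : ι → ℝ := fun i => if i ∈ Tᶜ then 1 else 0 with hv
  have hus : ∑ i ∈ S, u i = (S ∩ T).card := by
    simp [hu]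
  have hvs : ∑ i ∈ S, v i = (S ∩ Tᶜ).card := by
    simp only [hv, Finset.sum_boole, Finset.filter_mem_eq_inter]
  have hD : ∀ i j, blockDissim T θ₁ θ₂ θ₃ i j =
      θ₁ * (u i * u j) + θ₂ * (v i * v j) + θ₃ * (u i * v j) + θ₃ * (v i * u j)
        - (if i = j then θ₁ * u i + θ₂ * v i else 0) := by
    intro i j
    simp only [blockDissim, hu, hv, Finset.mem_compl]
    by_cases hij : i = j
    · subst hij
      by_cases hi : i ∈ T <;> simp [hi]
    · by_cases hi : i ∈ T <;> by_cases hj : j ∈ T <;> simp [hij, hi, hj]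
  have hdiag : ∀ i ∈ S, (∑ j ∈ S, if i = j then θ₁ * u i + θ₂ * v i else 0)
      = θ₁ * u i + θ₂ * v i := by
    intro i hi
    simp [hi]
  simp_rw [hD, Finset.sum_sub_distrib]
  rw [Finset.sum_congr rfl hdiag]
  simp_rw [Finset.sum_add_distrib, ← Finset.mul_sum, ← Finset.sum_mul, hus, hvs]
  ring

lemma block_criterion_lt {a b a' b' : ℕ} {θ₁ θ₂ θ₃ : ℝ} (hS : 0 < a + b) (hS' : 0 < a' + b')
    (hT : 0 < a + a') (hT' : 0 < b + b') (h : b ≠ 0 ∨ a' ≠ 0) (h' : a ≠ 0 ∨ b' ≠ 0)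
    (h₁ : θ₁ < θ₃) (h₂ : θ₂ < θ₃) :
    (2 * ((a : ℝ) + a'))⁻¹ * (θ₁ * ((a + a') * (a + a' - 1)))
        + (2 * ((b : ℝ) + b'))⁻¹ * (θ₂ * ((b + b') * (b + b' - 1))) <
      (2 * ((a : ℝ) + b))⁻¹ * (θ₁ * (a * (a - 1)) + θ₂ * (b * (b - 1)) + 2 * θ₃ * (a * b))
        + (2 * ((a' : ℝ) + b'))⁻¹
          * (θ₁ * (a' * (a' - 1)) + θ₂ * (b' * (b' - 1)) + 2 * θ₃ * (a' * b')) := by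
  have hs : (0 : ℝ) < a + b := by exact_mod_cast hS
  have hs' : (0 : ℝ) < a' + b' := by exact_mod_cast hS'
  have ht : (0 : ℝ) < a + a' := by exact_mod_cast hT
  have ht' : (0 : ℝ) < b + b' := by exact_mod_cast hT'
  set p : ℝ := a / (a + b) with hp
  set p' : ℝ := a' / (a' + b') with hp'
  set q : ℝ := b / (a + b) with hq
  set q' : ℝ := b' / (a' + b') with hq'
  have hpq : p + q = 1 := by rw [hp, hq]; field_simp
  have hpq' : p' + q' = 1 := by rw [hp', hq']; field_simp
  have hp0 : 0 ≤ p := by positivity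
  have hp0' : 0 ≤ p' := by positivity
  have hq0 : 0 ≤ q := by positivity
  have hq0' : 0 ≤ q' := by positivity
  have hK : p * b + p' * b' = q * a + q' * a' := by rw [hp, hp', hq, hq']; field_simp
  have hKpos : 0 < p * b + p' * b' := by
    have hor : (0 < a ∧ 0 < b) ∨ (0 < a' ∧ 0 < b') := by omega
    rcases hor with ⟨h1, h2⟩ | ⟨h1, h2⟩
    · have : 0 < p * b := by positivity
      have : 0 ≤ p' * b' := by positivity
      linarith
    · have : 0 < p' * b' := by positivity
      have : 0 ≤ p * b := by positivity
      linarith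
  have hcase : ∀ x y : ℕ, 0 < x + y → ∀ r s : ℝ, 0 ≤ r → 0 ≤ s → r ≤ 1 → s ≤ 1 →
      r + s - 1 ≤ r * x + s * y := by
    intro x y hxy r s hr hs hr1 hs1
    rcases Nat.eq_zero_or_pos x with hx | hx
    · have : (1 : ℝ) ≤ y := by exact_mod_cast (by omega : 1 ≤ y)
      have : 0 ≤ r * x := by positivity
      nlinarith
    · have : (1 : ℝ) ≤ x := by exact_mod_cast hx
      have : 0 ≤ s * y := by positivity
      nlinarith
  have hK1 := hcase b b' hT' p p' hp0 hp0' (by linarith) (by linarith)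
  have hK2 := hcase a a' hT q q' hq0 hq0' (by linarith) (by linarith)
  have key : (2 * ((a : ℝ) + b))⁻¹ * (θ₁ * (a * (a - 1)) + θ₂ * (b * (b - 1)) + 2 * θ₃ * (a * b))
        + (2 * ((a' : ℝ) + b'))⁻¹
          * (θ₁ * (a' * (a' - 1)) + θ₂ * (b' * (b' - 1)) + 2 * θ₃ * (a' * b'))
      - ((2 * ((a : ℝ) + a'))⁻¹ * (θ₁ * ((a + a') * (a + a' - 1)))
        + (2 * ((b : ℝ) + b'))⁻¹ * (θ₂ * ((b + b') * (b + b' - 1))))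
      = (p * b + p' * b') * (θ₃ - (θ₁ + θ₂) / 2) + (1 - p - p') * (θ₁ - θ₂) / 2 := by
    rw [hp, hp']
    field_simp
    ring
  rw [← sub_pos, key]
  rcases le_total θ₁ θ₂ with hle | hle
  · nlinarith [mul_pos hKpos (sub_pos.2 h₂)]
  · nlinarith [mul_pos hKpos (sub_pos.2 h₁)]

lemma withinCriterion_blockDissim_lt {ι : Type*} [Fintype ι] [DecidableEq ι] {T S : Finset ι}
    {θ₁ θ₂ θ₃ : ℝ} (h₁ : θ₁ < θ₃) (h₂ : θ₂ < θ₃) (hT : T.Nonempty) (hT' : T ≠ Finset.univ)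
    (hS : S.Nonempty) (hS' : S ≠ Finset.univ) (hST : S ≠ T) (hST' : S ≠ Tᶜ) :
    withinCriterion (blockDissim T θ₁ θ₂ θ₃) T < withinCriterion (blockDissim T θ₁ θ₂ θ₃) S := by
  have hsplit : ∀ A B : Finset ι, A.card = (A ∩ B).card + (A ∩ Bᶜ).card := fun A B => by
    rw [← Finset.sdiff_eq_inter_compl, Finset.card_inter_add_card_sdiff]
  have hcS := hsplit S T
  have hcS' := hsplit Sᶜ T
  have hcT := hsplit T S
  have hcT' := hsplit Tᶜ S
  rw [Finset.inter_comm T S, Finset.inter_comm T Sᶜ] at hcT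
  rw [Finset.inter_comm Tᶜ S, Finset.inter_comm Tᶜ Sᶜ] at hcT'
  have hSpos := hS.card_pos
  have hTpos := hT.card_pos
  have hSpos' : 0 < Sᶜ.card := by
    rw [Finset.card_pos, Finset.nonempty_iff_ne_empty, ne_eq, Finset.compl_eq_empty_iff]
    exact hS'
  have hTpos' : 0 < Tᶜ.card := by
    rw [Finset.card_pos, Finset.nonempty_iff_ne_empty, ne_eq, Finset.compl_eq_empty_iff]
    exact hT'
  have hne : (S ∩ Tᶜ).card ≠ 0 ∨ (Sᶜ ∩ T).card ≠ 0 := by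
    by_contra! hcon
    simp only [Finset.card_eq_zero, Finset.eq_empty_iff_forall_notMem, Finset.mem_inter,
      Finset.mem_compl] at hcon
    exact hST (by ext i; have := hcon.1 i; have := hcon.2 i; tauto)
  have hne' : (S ∩ T).card ≠ 0 ∨ (Sᶜ ∩ Tᶜ).card ≠ 0 := by
    by_contra! hcon
    simp only [Finset.card_eq_zero, Finset.eq_empty_iff_forall_notMem, Finset.mem_inter,
      Finset.mem_compl] at hcon
    exact hST' (by
      ext i; rw [Finset.mem_compl]; have := hcon.1 i; have := hcon.2 i; tauto)
  have hlt := block_criterion_lt (by omega) (by omega) (by omega) (by omega) hne hne' h₁ h₂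
  unfold withinCriterion
  simp only [sum_blockDissim]
  rw [hcS, hcS']
  simp only [Finset.inter_self, Finset.inter_compl, Finset.card_empty,
    Finset.inter_comm Tᶜ T, hcT, hcT']
  push_cast
  convert hlt using 2 <;> ring

lemma tendsto_measure_one_of_union_eq_univ {Ω : ℕ → Type*} {mΩ : ∀ d, MeasurableSpace (Ω d)}
    {P : ∀ d, Measure (Ω d)} (hP : ∀ d, IsProbabilityMeasure (P d)) {A B : ∀ d, Set (Ω d)}
    (hB : Tendsto (fun d => P d (B d)) atTop (nhds 0))
    (hAB : ∀ᶠ d in atTop, A d ∪ B d = Set.univ) :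
    Tendsto (fun d => P d (A d)) atTop (nhds 1) := by
  have hlow : Tendsto (fun d => 1 - P d (B d)) atTop (nhds 1) := by
    simpa using ENNReal.Tendsto.sub tendsto_const_nhds hB (Or.inl ENNReal.one_ne_top)
  refine tendsto_of_tendsto_of_tendsto_of_le_of_le' hlow tendsto_const_nhds ?_
    (Eventually.of_forall fun d => prob_le_one)
  filter_upwards [hAB] with d hd
  rw [tsub_le_iff_right, ← measure_univ (μ := P d), ← hd]
  exact measure_union_le _ _

/-- Entrywise convergence in probability of a finite matrix to `D₀` makes every neighbourhood
of `D₀` asymptotically certain. -/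
lemma tendsto_measure_one_of_mem_nhds {ι : Type*} [Fintype ι] {Ω : ℕ → Type*}
    {mΩ : ∀ d, MeasurableSpace (Ω d)} {P : ∀ d, Measure (Ω d)}
    (hP : ∀ d, IsProbabilityMeasure (P d)) {D : ∀ d, Ω d → ι → ι → ℝ} {D₀ : ι → ι → ℝ}
    (hD : ∀ i j, ∀ ε > (0 : ℝ),
      Tendsto (fun d => P d {ω | ε < |D d ω i j - D₀ i j|}) atTop (nhds 0))
    {U : Set (ι → ι → ℝ)} (hU : U ∈ nhds D₀) {A : ∀ d, Set (Ω d)}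
    (hA : ∀ᶠ d in atTop, D d ⁻¹' U ⊆ A d) :
    Tendsto (fun d => P d (A d)) atTop (nhds 1) := by
  obtain ⟨ε, hε, hball⟩ := Metric.nhds_basis_closedBall.mem_iff.1 hU
  have hB : Tendsto (fun d => P d (⋃ i, ⋃ j, {ω | ε < |D d ω i j - D₀ i j|})) atTop
      (nhds 0) := by
    have hsum : Tendsto (fun d => ∑ i, ∑ j, P d {ω | ε < |D d ω i j - D₀ i j|}) atTop
        (nhds 0) := by
      simpa using tendsto_finsetSum Finset.univ fun i _ =>
        tendsto_finsetSum Finset.univ fun j _ => hD i j ε hε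
    refine tendsto_of_tendsto_of_tendsto_of_le_of_le tendsto_const_nhds hsum
      (fun d => zero_le) fun d => ?_
    exact (measure_iUnion_fintype_le _ _).trans
      (Finset.sum_le_sum fun i _ => measure_iUnion_fintype_le _ _)
  refine tendsto_measure_one_of_union_eq_univ hP hB ?_
  filter_upwards [hA] with d hd
  refine Set.eq_univ_of_forall fun ω => ?_
  by_cases hω : ω ∈ ⋃ i, ⋃ j, {ω | ε < |D d ω i j - D₀ i j|}
  · exact Or.inr hω
  · refine Or.inl (hd (hball ?_))
    simp only [Set.mem_iUnion, Set.mem_ofPred_eq, not_exists, not_lt] at hω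
    rw [Metric.mem_closedBall, dist_pi_le_iff hε.le]
    intro i
    rw [dist_pi_le_iff hε.le]
    exact fun j => hω i j

/-- **Lemma 3(i).** If pairwise scaled squared distances concentrate at `θ₁`
(within the first group), `θ₂` (within the second group) and `θ₃ > max(θ₁,θ₂)`
(across groups), then with probability tending to one, `λ₀(S_τ)` is strictly
smaller than `λ₀(S)` for every nonempty proper `S ∉ {S_τ, S_τᶜ}`; consequently,
with probability tending to one, any minimizer `S₀` of `λ₀` equals `S_τ` or `S_τᶜ`. -/
theorem stmt_7 (n τ : ℕ) (hn : 2 ≤ n) (hτ1 : 1 ≤ τ) (hτn : τ ≤ n - 1)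
    (Ω : ℕ → Type*) (mΩ : ∀ d, MeasurableSpace (Ω d))
    (P : ∀ d, Measure (Ω d)) (hP : ∀ d, IsProbabilityMeasure (P d))
    (X : ∀ d : ℕ, Fin n → Ω d → EuclideanSpace ℝ (Fin d))
    (θ₁ θ₂ θ₃ : ℝ)
    (ha : ∀ i j : Fin n, (i : ℕ) < (j : ℕ) → (j : ℕ) < τ → ∀ ε > (0 : ℝ),
      Tendsto (fun d : ℕ => P d {ω | ε < |‖X d i ω - X d j ω‖ ^ 2 / (d : ℝ) - θ₁|})
        atTop (nhds 0))
    (hb : ∀ i j : Fin n, τ ≤ (i : ℕ) → (i : ℕ) < (j : ℕ) → ∀ ε > (0 : ℝ),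
      Tendsto (fun d : ℕ => P d {ω | ε < |‖X d i ω - X d j ω‖ ^ 2 / (d : ℝ) - θ₂|})
        atTop (nhds 0))
    (hc : ∀ i j : Fin n, (i : ℕ) < τ → τ ≤ (j : ℕ) → ∀ ε > (0 : ℝ),
      Tendsto (fun d : ℕ => P d {ω | ε < |‖X d i ω - X d j ω‖ ^ 2 / (d : ℝ) - θ₃|})
        atTop (nhds 0))
    (hθ : max θ₁ θ₂ < θ₃) :
    Tendsto (fun d : ℕ => P d {ω | ∀ S : Finset (Fin n),
        S.Nonempty → S ≠ Finset.univ → S ≠ sTau n τ → S ≠ (sTau n τ)ᶜ →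
        lambda0 (fun k => X d k ω) (sTau n τ) < lambda0 (fun k => X d k ω) S})
      atTop (nhds 1)
    ∧ Tendsto (fun d : ℕ => P d {ω | ∀ S₀ : Finset (Fin n),
        S₀.Nonempty → S₀ ≠ Finset.univ →
        (∀ S : Finset (Fin n), S.Nonempty → S ≠ Finset.univ →
          lambda0 (fun k => X d k ω) S₀ ≤ lambda0 (fun k => X d k ω) S) →
        (S₀ = sTau n τ ∨ S₀ = (sTau n τ)ᶜ)})
      atTop (nhds 1) := by
  have h₁ : θ₁ < θ₃ := (le_max_left _ _).trans_lt hθ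
  have h₂ : θ₂ < θ₃ := (le_max_right _ _).trans_lt hθ
  have hmem : ∀ i : Fin n, i ∈ sTau n τ ↔ (i : ℕ) < τ := fun i => by simp [sTau]
  have hT : (sTau n τ).Nonempty := ⟨⟨0, by omega⟩, (hmem _).2 (by simp; omega)⟩
  have hT' : sTau n τ ≠ Finset.univ := fun h => by
    have := (hmem ⟨n - 1, by omega⟩).1 (h ▸ Finset.mem_univ _)
    simp at this
    omega
  set D₀ := blockDissim (sTau n τ) θ₁ θ₂ θ₃ with hD₀
  have hlt : ∀ i j : Fin n, (i : ℕ) < j → ∀ ε > (0 : ℝ), Tendsto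
      (fun d : ℕ => P d {ω | ε < |‖X d i ω - X d j ω‖ ^ 2 / (d : ℝ) - D₀ i j|})
      atTop (nhds 0) := by
    intro i j hij
    have hne : i ≠ j := fun h => by simp [h] at hij
    by_cases hj : (j : ℕ) < τ
    · have hi : (i : ℕ) < τ := hij.trans hj
      have hval : D₀ i j = θ₁ := by simp [hD₀, blockDissim, hmem, hne, hi, hj]
      rw [hval]
      exact ha i j hij hj
    by_cases hi : (i : ℕ) < τ
    · have hval : D₀ i j = θ₃ := by simp [hD₀, blockDissim, hmem, hne, hi, hj]
      rw [hval]
      exact hc i j hi (not_lt.1 hj)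
    · have hval : D₀ i j = θ₂ := by simp [hD₀, blockDissim, hmem, hne, hi, hj]
      rw [hval]
      exact hb i j (not_lt.1 hi) hij
  have hconv : ∀ i j : Fin n, ∀ ε > (0 : ℝ), Tendsto
      (fun d : ℕ => P d {ω | ε < |‖X d i ω - X d j ω‖ ^ 2 / (d : ℝ) - D₀ i j|})
      atTop (nhds 0) := by
    intro i j ε hε
    rcases lt_trichotomy (i : ℕ) j with hij | hij | hij
    · exact hlt i j hij ε hε
    · obtain rfl := Fin.ext hij
      have hval : D₀ i i = 0 := by simp [hD₀, blockDissim]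
      simp [hval, hε.le.not_gt]
    · have := hlt j i hij ε hε
      rw [hD₀, blockDissim_comm]
      simpa only [norm_sub_rev] using this
  have hU : {D : Fin n → Fin n → ℝ | ∀ S : Finset (Fin n),
      S.Nonempty → S ≠ Finset.univ → S ≠ sTau n τ → S ≠ (sTau n τ)ᶜ →
      withinCriterion D (sTau n τ) < withinCriterion D S} ∈ nhds D₀ := by
    change ∀ᶠ D in nhds D₀, _
    simp only [eventually_all]
    intro S hS hS' hST hST'
    exact (continuous_withinCriterion _).continuousAt.eventually_lt
      (continuous_withinCriterion _).continuousAt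
      (withinCriterion_blockDissim_lt h₁ h₂ hT hT' hS hS' hST hST')
  have hstrict : ∀ᶠ d : ℕ in atTop,
      (fun ω i j => ‖X d i ω - X d j ω‖ ^ 2 / (d : ℝ)) ⁻¹'
        {D : Fin n → Fin n → ℝ | ∀ S : Finset (Fin n),
          S.Nonempty → S ≠ Finset.univ → S ≠ sTau n τ → S ≠ (sTau n τ)ᶜ →
          withinCriterion D (sTau n τ) < withinCriterion D S} ⊆
      {ω | ∀ S : Finset (Fin n),
        S.Nonempty → S ≠ Finset.univ → S ≠ sTau n τ → S ≠ (sTau n τ)ᶜ →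
        lambda0 (fun k => X d k ω) (sTau n τ) < lambda0 (fun k => X d k ω) S} := by
    filter_upwards [eventually_gt_atTop 0] with d hd ω hω S hS hS' hST hST'
    have hd' : (0 : ℝ) < d := by exact_mod_cast hd
    rw [lambda0_eq_mul_withinCriterion _ _ hd'.ne', lambda0_eq_mul_withinCriterion _ S hd'.ne']
    exact mul_lt_mul_of_pos_left (hω S hS hS' hST hST') hd'
  refine ⟨tendsto_measure_one_of_mem_nhds hP hconv hU hstrict,
    tendsto_measure_one_of_mem_nhds hP hconv hU ?_⟩
  filter_upwards [hstrict] with d hd ω hω S₀ hS₀ hS₀' hmin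
  by_contra! hcon
  exact (hd hω S₀ hS₀ hS₀' hcon.1 hcon.2).not_ge (hmin _ hT hT')
end

section
/- Let n ≥ 3 and 1 ≤ τ ≤ n−1, and for each dimension d let X_1(d),…,X_n(d) be random vectors in ℝ^d (on a probability space depending on d) such that, as d → ∞: (a) d^{-1}‖X_i(d) − X_j(d)‖² → θ₁ in probability for i < j ≤ τ; (b) d^{-1}‖X_i(d) − X_j(d)‖² → θ₂ in probability for τ < i < j; (c) d^{-1}‖X_i(d) − X_j(d)‖² → θ₃ in probability for i ≤ τ < j. If θ₁ < θ₂ and θ₃ = (θ₁ + θ₂)/2, then P( for every j > τ and every nonempty proper subset S of {1,…,n} that is not of the form {j'} or {j'}ᶜ for some j' > τ, λ₀({j}) < λ₀(S) ) → 1 as d → ∞; consequently, with probability tending to one, any minimizer S₀ of λ₀ satisfies |S₀| = 1 or |S₀ᶜ| = 1, where the singleton is {j} for some j > τ. -/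
open MeasureTheory Filter

/-- The within-group criterion `lambda0` computed from a table `M` of squared distances. -/
noncomputable def withinGroupCriterion {n : ℕ} (M : Fin n × Fin n → ℝ) (S : Finset (Fin n)) : ℝ :=
  (2 * (S.card : ℝ))⁻¹ * ∑ i ∈ S, ∑ j ∈ S, M (i, j)
    + (2 * ((Sᶜ).card : ℝ))⁻¹ * ∑ i ∈ Sᶜ, ∑ j ∈ Sᶜ, M (i, j)

lemma lambda0_eq_withinGroupCriterion {E : Type*} [NormedAddCommGroup E] {n : ℕ}
    (X : Fin n → E) (S : Finset (Fin n)) :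
    lambda0 X S = withinGroupCriterion (fun p => ‖X p.1 - X p.2‖ ^ 2) S := rfl

lemma withinGroupCriterion_div {n : ℕ} (M : Fin n × Fin n → ℝ) (S : Finset (Fin n)) (c : ℝ) :
    withinGroupCriterion (fun p => M p / c) S = withinGroupCriterion M S / c := by
  simp only [withinGroupCriterion, ← Finset.sum_div]
  ring

lemma continuous_withinGroupCriterion {n : ℕ} (S : Finset (Fin n)) :
    Continuous fun M : Fin n × Fin n → ℝ => withinGroupCriterion M S := by
  unfold withinGroupCriterion
  fun_prop

/-- The squared-distance table whose off-diagonal entries are sums of weights `w i + w j`. -/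
noncomputable def additiveTable {ι : Type*} [DecidableEq ι] (w : ι → ℝ) (p : ι × ι) : ℝ :=
  if p.1 = p.2 then 0 else w p.1 + w p.2

lemma sum_sum_additiveTable {ι : Type*} [DecidableEq ι] (w : ι → ℝ) (S : Finset ι) :
    ∑ i ∈ S, ∑ j ∈ S, additiveTable w (i, j) = 2 * ((S.card : ℝ) - 1) * ∑ i ∈ S, w i := by
  have h : ∀ i j, additiveTable w (i, j) = (w i + w j) - if i = j then 2 * w i else 0 := by
    intro i j
    by_cases hij : i = j
    · subst hij
      simp [additiveTable]
      ring
    · simp [additiveTable, hij]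
  simp only [h, Finset.sum_sub_distrib, Finset.sum_add_distrib, Finset.sum_const, nsmul_eq_mul,
    Finset.sum_ite_eq, Finset.sum_ite_mem, Finset.inter_self, ← Finset.mul_sum]
  ring

lemma withinGroupCriterion_additiveTable {n : ℕ} (w : Fin n → ℝ) {S : Finset (Fin n)}
    (hS : S.Nonempty) (hS' : S ≠ Finset.univ) :
    withinGroupCriterion (additiveTable w) S
      = ∑ i, w i - (∑ i ∈ S, w i) / S.card - (∑ i ∈ Sᶜ, w i) / (Sᶜ).card := by
  have h1 : (S.card : ℝ) ≠ 0 := by exact_mod_cast hS.card_ne_zero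
  have h2 : ((Sᶜ).card : ℝ) ≠ 0 := by
    have : (Sᶜ).Nonempty := by
      rwa [Finset.nonempty_iff_ne_empty, Ne, Finset.compl_eq_empty_iff]
    exact_mod_cast this.card_ne_zero
  rw [withinGroupCriterion, sum_sum_additiveTable, sum_sum_additiveTable,
    ← Finset.sum_add_sum_compl S w]
  field_simp
  ring

/-- The weight `a` on the indices below `τ` and `b` on the others. -/
noncomputable def twoLevelWeight {n : ℕ} (τ : ℕ) (a b : ℝ) (i : Fin n) : ℝ :=
  if (i : ℕ) < τ then a else b

lemma sum_twoLevelWeight_div_card {n : ℕ} (τ : ℕ) (a b : ℝ) {S : Finset (Fin n)}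
    (hS : S.Nonempty) :
    (∑ i ∈ S, twoLevelWeight τ a b i) / S.card
      = b - (b - a) * ((S.filter fun i : Fin n => (i : ℕ) < τ).card / S.card : ℝ) := by
  have h1 : (S.card : ℝ) ≠ 0 := by exact_mod_cast hS.card_ne_zero
  have h : ∀ i : Fin n, twoLevelWeight τ a b i = b - (b - a) * if (i : ℕ) < τ then 1 else 0 := by
    intro i
    unfold twoLevelWeight
    split_ifs <;> ring
  simp only [h, Finset.sum_sub_distrib, ← Finset.mul_sum, Finset.sum_boole, Finset.sum_const,
    nsmul_eq_mul]
  field_simp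

/-- If neither `S` nor `Sᶜ` is a single index `≥ τ`, the fractions of indices below `τ` in `S` and
in `Sᶜ` add up to more than they do for a partition isolating a single index `≥ τ`. -/
lemma card_div_lt_add_card_div {n τ : ℕ} (hn : 3 ≤ n) (hτ1 : 1 ≤ τ) {S : Finset (Fin n)}
    (hS : S.Nonempty) (hS' : S ≠ Finset.univ)
    (hne : ¬ ∃ j : Fin n, τ ≤ (j : ℕ) ∧ (S = {j} ∨ S = ({j} : Finset (Fin n))ᶜ)) :
    ((Finset.univ.filter fun i : Fin n => (i : ℕ) < τ).card / ((n : ℝ) - 1))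
      < (S.filter fun i : Fin n => (i : ℕ) < τ).card / (S.card : ℝ)
        + (Sᶜ.filter fun i : Fin n => (i : ℕ) < τ).card / ((Sᶜ).card : ℝ) := by
  have hSc : (Sᶜ).Nonempty := by
    rwa [Finset.nonempty_iff_ne_empty, Ne, Finset.compl_eq_empty_iff]
  have hz : (Finset.univ.filter fun i : Fin n => (i : ℕ) < τ).card
      = (S.filter fun i : Fin n => (i : ℕ) < τ).card
        + (Sᶜ.filter fun i : Fin n => (i : ℕ) < τ).card := by
    rw [← Finset.card_union_of_disjoint
      (Finset.disjoint_filter_filter disjoint_compl_right), ← Finset.filter_union,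
      Finset.union_compl]
  have hzpos : 0 < (Finset.univ.filter fun i : Fin n => (i : ℕ) < τ).card :=
    Finset.card_pos.2 ⟨⟨0, by omega⟩, by simp; omega⟩
  have hcard : S.card + (Sᶜ).card = n := by
    simp
  have key : ∀ T : Finset (Fin n), T.card = 1 → (T = S ∨ T = Sᶜ) →
      0 < (T.filter fun i : Fin n => (i : ℕ) < τ).card := by
    intro T hT hTS
    obtain ⟨j, rfl⟩ := Finset.card_eq_one.1 hT
    by_contra h0
    have hj : τ ≤ (j : ℕ) := by
      by_contra hlt
      exact h0 (Finset.card_pos.2 ⟨j, by simp; omega⟩)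
    refine hne ⟨j, hj, ?_⟩
    rcases hTS with h | h
    · exact Or.inl h.symm
    · exact Or.inr (by rw [h, compl_compl])
  have k1 := fun h => key S h (Or.inl rfl)
  have k2 := fun h => key Sᶜ h (Or.inr rfl)
  have p1 := hS.card_pos
  have p2 := hSc.card_pos
  rw [hz] at hzpos ⊢
  generalize (S.filter fun i : Fin n => (i : ℕ) < τ).card = y at *
  generalize (Sᶜ.filter fun i : Fin n => (i : ℕ) < τ).card = z at *
  generalize S.card = s at *
  generalize (Sᶜ).card = t at *
  have hsR : (0 : ℝ) < s := by exact_mod_cast p1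
  have htR : (0 : ℝ) < t := by exact_mod_cast p2
  have hs1 : (1 : ℝ) ≤ s := by exact_mod_cast p1
  have ht1 : (1 : ℝ) ≤ t := by exact_mod_cast p2
  have hnR : (n : ℝ) - 1 = s + t - 1 := by rw [← hcard]; push_cast; ring
  have hpos : (0 : ℝ) < s + t - 1 := by linarith
  rw [hnR, ← sub_pos]
  have e : (y / s + z / t - ((y + z : ℕ) : ℝ) / (s + t - 1) : ℝ)
      = (y * (t - 1) / s + z * (s - 1) / t) / (s + t - 1) := by
    push_cast
    field_simp
    ring
  rw [e]
  refine div_pos ?_ hpos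
  have hy : (0 : ℝ) ≤ y * (t - 1) / s :=
    div_nonneg (mul_nonneg (Nat.cast_nonneg y) (by linarith)) hsR.le
  have hz' : (0 : ℝ) ≤ z * (s - 1) / t :=
    div_nonneg (mul_nonneg (Nat.cast_nonneg z) (by linarith)) htR.le
  have hor : (0 < y ∧ 1 < t) ∨ (0 < z ∧ 1 < s) := by
    by_cases h1 : s = 1
    · exact Or.inl ⟨k1 h1, by omega⟩
    · by_cases h2 : t = 1
      · exact Or.inr ⟨k2 h2, by omega⟩
      · omega
  rcases hor with ⟨h1, h2⟩ | ⟨h1, h2⟩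
  · have h1' : (0 : ℝ) < y := by exact_mod_cast h1
    have h2' : (1 : ℝ) < t := by exact_mod_cast h2
    exact add_pos_of_pos_of_nonneg (div_pos (mul_pos h1' (by linarith)) hsR) hz'
  · have h1' : (0 : ℝ) < z := by exact_mod_cast h1
    have h2' : (1 : ℝ) < s := by exact_mod_cast h2
    exact add_pos_of_nonneg_of_pos hy (div_pos (mul_pos h1' (by linarith)) htR)

lemma singleton_ne_univ_of_two_le {n : ℕ} (hn : 2 ≤ n) (j : Fin n) :
    ({j} : Finset (Fin n)) ≠ Finset.univ := by
  intro h
  have := congrArg Finset.card h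
  rw [Finset.card_singleton, Finset.card_univ, Fintype.card_fin] at this
  omega

lemma withinGroupCriterion_singleton_lt {n τ : ℕ} (hn : 3 ≤ n) (hτ1 : 1 ≤ τ) {a b : ℝ}
    (hab : a < b) {j : Fin n} (hj : τ ≤ (j : ℕ)) {S : Finset (Fin n)}
    (hS : S.Nonempty) (hS' : S ≠ Finset.univ)
    (hne : ¬ ∃ j : Fin n, τ ≤ (j : ℕ) ∧ (S = {j} ∨ S = ({j} : Finset (Fin n))ᶜ)) :
    withinGroupCriterion (additiveTable (twoLevelWeight τ a b)) {j}
      < withinGroupCriterion (additiveTable (twoLevelWeight τ a b)) S := by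
  have hSc : (Sᶜ).Nonempty := by
    rwa [Finset.nonempty_iff_ne_empty, Ne, Finset.compl_eq_empty_iff]
  have hju := singleton_ne_univ_of_two_le (by omega : 2 ≤ n) j
  have hjc : (({j} : Finset (Fin n))ᶜ).Nonempty := by
    rwa [Finset.nonempty_iff_ne_empty, Ne, Finset.compl_eq_empty_iff]
  have hfilter : (({j} : Finset (Fin n))ᶜ.filter fun i : Fin n => (i : ℕ) < τ)
      = Finset.univ.filter fun i : Fin n => (i : ℕ) < τ := by
    ext i
    simp only [Finset.mem_filter, Finset.mem_compl, Finset.mem_singleton, Finset.mem_univ,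
      true_and, and_iff_right_iff_imp]
    rintro hi rfl
    omega
  have hjcard : ((({j} : Finset (Fin n))ᶜ).card : ℝ) = n - 1 := by
    rw [Finset.card_compl, Finset.card_singleton, Fintype.card_fin, Nat.cast_sub (by omega)]
    simp
  have hjfilter : (({j} : Finset (Fin n)).filter fun i : Fin n => (i : ℕ) < τ) = ∅ := by
    simp [Finset.filter_singleton, hj]
  rw [withinGroupCriterion_additiveTable _ (Finset.singleton_nonempty j) hju,
    withinGroupCriterion_additiveTable _ hS hS',
    sum_twoLevelWeight_div_card τ a b hS, sum_twoLevelWeight_div_card τ a b hSc,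
    sum_twoLevelWeight_div_card τ a b (Finset.singleton_nonempty j),
    sum_twoLevelWeight_div_card τ a b hjc, hfilter, hjcard, hjfilter]
  have := mul_lt_mul_of_pos_left (card_div_lt_add_card_div hn hτ1 hS hS' hne) (sub_pos.2 hab)
  simp only [Finset.card_empty, Nat.cast_zero, zero_div, mul_zero]
  linarith

/-- Near the limiting table, the high singletons beat every partition that does not isolate a
single high index. -/
lemma eventually_withinGroupCriterion_singleton_lt {n τ : ℕ} (hn : 3 ≤ n) (hτ1 : 1 ≤ τ) {a b : ℝ}
    (hab : a < b) :
    ∀ᶠ M in nhds (additiveTable (twoLevelWeight (n := n) τ a b)), ∀ j : Fin n, τ ≤ (j : ℕ) →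
      ∀ S : Finset (Fin n), S.Nonempty → S ≠ Finset.univ →
      (¬ ∃ j' : Fin n, τ ≤ (j' : ℕ) ∧ (S = {j'} ∨ S = ({j'} : Finset (Fin n))ᶜ)) →
      withinGroupCriterion M {j} < withinGroupCriterion M S := by
  simp only [eventually_all]
  intro j hj S hS hS' hne
  exact (continuous_withinGroupCriterion _).continuousAt.eventually_lt
    (continuous_withinGroupCriterion _).continuousAt
    (withinGroupCriterion_singleton_lt hn hτ1 hab hj hS hS' hne)

/-- A property holding near the limit in probability of a finite family of real functions holds
along the family with probability tending to one. -/
lemma tendsto_measure_one_of_tendsto_inProbability {κ : Type*} [Fintype κ]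
    {Ω : ℕ → Type*} {mΩ : ∀ d, MeasurableSpace (Ω d)} {P : ∀ d, Measure (Ω d)}
    (hP : ∀ d, IsProbabilityMeasure (P d)) {Y : ∀ d, κ → Ω d → ℝ} {y : κ → ℝ}
    (hY : ∀ k, ∀ ε > (0 : ℝ),
      Tendsto (fun d => P d {ω | ε < |Y d k ω - y k|}) atTop (nhds 0))
    {U : Set (κ → ℝ)} (hU : U ∈ nhds y) {G : ∀ d, Set (Ω d)}
    (hG : ∀ᶠ d in atTop, ∀ ω, (fun k => Y d k ω) ∈ U → ω ∈ G d) :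
    Tendsto (fun d => P d (G d)) atTop (nhds 1) := by
  obtain ⟨ε, hε, hball⟩ := Metric.nhds_basis_closedBall.mem_iff.1 hU
  have hsum : Tendsto (fun d => 1 - ∑ k, P d {ω | ε < |Y d k ω - y k|}) atTop (nhds 1) := by
    have h0 := tendsto_finsetSum Finset.univ fun k _ => hY k ε hε
    rw [Finset.sum_const_zero] at h0
    have := ENNReal.Tendsto.sub (tendsto_const_nhds (x := (1 : ENNReal))) h0
      (Or.inl ENNReal.one_ne_top)
    rwa [tsub_zero] at this
  refine tendsto_of_tendsto_of_tendsto_of_le_of_le' hsum tendsto_const_nhds ?_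
    (Eventually.of_forall fun d => prob_le_one)
  filter_upwards [hG] with d hd
  rw [tsub_le_iff_right, ← measure_univ (μ := P d)]
  calc P d Set.univ ≤ P d (G d ∪ ⋃ k, {ω | ε < |Y d k ω - y k|}) := by
        refine measure_mono fun ω _ => ?_
        by_cases h : ∃ k, ε < |Y d k ω - y k|
        · exact Or.inr (Set.mem_iUnion.2 h)
        · push Not at h
          refine Or.inl (hd ω (hball ?_))
          rw [Metric.mem_closedBall, dist_pi_le_iff hε.le]
          exact h
    _ ≤ P d (G d) + ∑ k, P d {ω | ε < |Y d k ω - y k|} :=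
        (measure_union_le _ _).trans (by gcongr; exact measure_iUnion_fintype_le _ _)

/-- **Lemma 3(ii).** If pairwise scaled squared distances concentrate at `θ₁ < θ₂`
within the two groups and at `θ₃ = (θ₁+θ₂)/2` across groups, then with probability
tending to one, `λ₀({j}) < λ₀(S)` for every `j > τ` and every nonempty proper `S`
which is not of the form `{j'}` or `{j'}ᶜ` with `j' > τ`; consequently, with
probability tending to one, any minimizer `S₀` of `λ₀` satisfies `S₀ = {j}` or
`S₀ = {j}ᶜ` for some `j > τ`. -/
theorem stmt_8 (n τ : ℕ) (hn : 3 ≤ n) (hτ1 : 1 ≤ τ) (hτn : τ ≤ n - 1)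
    (Ω : ℕ → Type*) (mΩ : ∀ d, MeasurableSpace (Ω d))
    (P : ∀ d, Measure (Ω d)) (hP : ∀ d, IsProbabilityMeasure (P d))
    (X : ∀ d : ℕ, Fin n → Ω d → EuclideanSpace ℝ (Fin d))
    (θ₁ θ₂ θ₃ : ℝ)
    (ha : ∀ i j : Fin n, (i : ℕ) < (j : ℕ) → (j : ℕ) < τ → ∀ ε > (0 : ℝ),
      Tendsto (fun d : ℕ => P d {ω | ε < |‖X d i ω - X d j ω‖ ^ 2 / (d : ℝ) - θ₁|})
        atTop (nhds 0))
    (hb : ∀ i j : Fin n, τ ≤ (i : ℕ) → (i : ℕ) < (j : ℕ) → ∀ ε > (0 : ℝ),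
      Tendsto (fun d : ℕ => P d {ω | ε < |‖X d i ω - X d j ω‖ ^ 2 / (d : ℝ) - θ₂|})
        atTop (nhds 0))
    (hc : ∀ i j : Fin n, (i : ℕ) < τ → τ ≤ (j : ℕ) → ∀ ε > (0 : ℝ),
      Tendsto (fun d : ℕ => P d {ω | ε < |‖X d i ω - X d j ω‖ ^ 2 / (d : ℝ) - θ₃|})
        atTop (nhds 0))
    (hθ12 : θ₁ < θ₂) (hθ3 : θ₃ = (θ₁ + θ₂) / 2) :
    Tendsto (fun d : ℕ => P d {ω | ∀ j : Fin n, τ ≤ (j : ℕ) →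
        ∀ S : Finset (Fin n), S.Nonempty → S ≠ Finset.univ →
        (¬ ∃ j' : Fin n, τ ≤ (j' : ℕ) ∧ (S = {j'} ∨ S = ({j'} : Finset (Fin n))ᶜ)) →
        lambda0 (fun k => X d k ω) {j} < lambda0 (fun k => X d k ω) S})
      atTop (nhds 1)
    ∧ Tendsto (fun d : ℕ => P d {ω | ∀ S₀ : Finset (Fin n),
        S₀.Nonempty → S₀ ≠ Finset.univ →
        (∀ S : Finset (Fin n), S.Nonempty → S ≠ Finset.univ →
          lambda0 (fun k => X d k ω) S₀ ≤ lambda0 (fun k => X d k ω) S) →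
        (∃ j : Fin n, τ ≤ (j : ℕ) ∧ (S₀ = {j} ∨ S₀ = ({j} : Finset (Fin n))ᶜ))})
      atTop (nhds 1) := by
  have hτ : τ < n := by omega
  have hab : θ₁ / 2 < θ₂ / 2 := by linarith
  let D : Fin n × Fin n → ℝ := additiveTable (twoLevelWeight τ (θ₁ / 2) (θ₂ / 2))
  have hlt : ∀ i j : Fin n, i < j → D (i, j) =
      if (j : ℕ) < τ then θ₁ else if (i : ℕ) < τ then θ₃ else θ₂ := by
    intro i j hij
    have hij' : (i : ℕ) < j := hij
    simp only [D, additiveTable, twoLevelWeight, hij.ne, if_false]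
    split_ifs <;> first | omega | linarith
  have hY : ∀ p : Fin n × Fin n, ∀ ε > (0 : ℝ),
      Tendsto (fun d : ℕ => P d {ω | ε < |‖X d p.1 ω - X d p.2 ω‖ ^ 2 / (d : ℝ) - D p|})
        atTop (nhds 0) := by
    have hup : ∀ i j : Fin n, i < j → ∀ ε > (0 : ℝ),
        Tendsto (fun d : ℕ => P d {ω | ε < |‖X d i ω - X d j ω‖ ^ 2 / (d : ℝ) - D (i, j)|})
          atTop (nhds 0) := by
      intro i j hij
      rw [hlt i j hij]
      split_ifs with h1 h2
      · exact ha i j hij h1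
      · exact hc i j h2 (by omega)
      · exact hb i j (by omega) hij
    rintro ⟨i, j⟩ ε hε
    rcases lt_trichotomy i j with h | rfl | h
    · exact hup i j h ε hε
    · simp [D, additiveTable, hε.not_gt]
    · have hsymm : D (i, j) = D (j, i) := by
        simp only [D, additiveTable, h.ne, h.ne', if_false]
        ring
      simpa only [hsymm, norm_sub_rev] using hup j i h ε hε
  have hU := eventually_withinGroupCriterion_singleton_lt hn hτ1 hab
  have hscale : ∀ᶠ d : ℕ in atTop, ∀ ω,
      (∀ j : Fin n, τ ≤ (j : ℕ) →
        ∀ S : Finset (Fin n), S.Nonempty → S ≠ Finset.univ →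
        (¬ ∃ j' : Fin n, τ ≤ (j' : ℕ) ∧ (S = {j'} ∨ S = ({j'} : Finset (Fin n))ᶜ)) →
        withinGroupCriterion (fun p => ‖X d p.1 ω - X d p.2 ω‖ ^ 2 / (d : ℝ)) {j}
          < withinGroupCriterion (fun p => ‖X d p.1 ω - X d p.2 ω‖ ^ 2 / (d : ℝ)) S) →
      ∀ j : Fin n, τ ≤ (j : ℕ) →
        ∀ S : Finset (Fin n), S.Nonempty → S ≠ Finset.univ →
        (¬ ∃ j' : Fin n, τ ≤ (j' : ℕ) ∧ (S = {j'} ∨ S = ({j'} : Finset (Fin n))ᶜ)) →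
        lambda0 (fun k => X d k ω) {j} < lambda0 (fun k => X d k ω) S := by
    filter_upwards [eventually_gt_atTop 0] with d hd ω hω j hj S hS hS' hne
    have h := hω j hj S hS hS' hne
    have hd' : (0 : ℝ) < d := by exact_mod_cast hd
    rwa [withinGroupCriterion_div (fun p => ‖X d p.1 ω - X d p.2 ω‖ ^ 2),
      withinGroupCriterion_div (fun p => ‖X d p.1 ω - X d p.2 ω‖ ^ 2),
      div_lt_div_iff_of_pos_right hd'] at h
  refine ⟨tendsto_measure_one_of_tendsto_inProbability hP hY hU hscale,
    tendsto_measure_one_of_tendsto_inProbability hP hY hU (hscale.mono ?_)⟩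
  intro d hd ω hω S₀ hS hS' hmin
  by_contra hne
  have hlt := hd ω hω ⟨τ, hτ⟩ le_rfl S₀ hS hS' hne
  have hju := singleton_ne_univ_of_two_le (by omega : 2 ≤ n) ⟨τ, hτ⟩
  have hle := hmin {⟨τ, hτ⟩} (Finset.singleton_nonempty _) hju
  exact absurd hlt hle.not_gt
end

section
/- Let n, τ, k₁, k₂ be integers with 1 ≤ τ ≤ n−1, 0 ≤ k₁ ≤ τ, 0 ≤ k₂ ≤ n−τ, and set k = k₁ + k₂. Assume 1 ≤ k ≤ n−1 and (k₁, k₂) ∉ {(τ, 0), (0, n−τ)}. Let θ₁, θ₂, θ₃ be real numbers with θ₃ > max(θ₁, θ₂). Then (1/(2k))·[ k₁(k₁−1)θ₁ + k₂(k₂−1)θ₂ + 2k₁k₂θ₃ ] + (1/(2(n−k)))·[ (τ−k₁)(τ−k₁−1)θ₁ + (n−τ−k₂)(n−τ−k₂−1)θ₂ + 2(τ−k₁)(n−τ−k₂)θ₃ ] > (1/2)·[ (τ−1)θ₁ + (n−τ−1)θ₂ ]. -/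
/-- For natural numbers, `a * (b + 1) / (a + b) ≥ 1` as soon as `a ≥ 1`. -/
lemma one_le_mul_add_one_div_add {a : ℕ} (b : ℕ) (ha : 1 ≤ a) :
    (1 : ℝ) ≤ a * (b + 1) / (a + b) := by
  have ha' : (1 : ℝ) ≤ a := by exact_mod_cast ha
  have hb : (0 : ℝ) ≤ b := b.cast_nonneg
  rw [le_div_iff₀ (by linarith)]
  nlinarith [mul_nonneg (sub_nonneg.2 ha') hb]

lemma one_le_mul_add_one_div_add_add {a c : ℕ} (b d : ℕ) (h : 1 ≤ a + c) :
    (1 : ℝ) ≤ a * (b + 1) / (a + b) + c * (d + 1) / (c + d) := by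
  have hab : (0 : ℝ) ≤ a * (b + 1) / (a + b) := by positivity
  have hcd : (0 : ℝ) ≤ c * (d + 1) / (c + d) := by positivity
  rcases Nat.eq_zero_or_pos a with rfl | ha
  · have := one_le_mul_add_one_div_add d (show 1 ≤ c by omega)
    linarith
  · have := one_le_mul_add_one_div_add b ha
    linarith

/-- The two-cluster inequality in terms of the four cell counts `a, b, c, d`. -/
lemma two_cluster_criterion_lt (a b c d : ℕ) {θ₁ θ₂ θ₃ : ℝ}
    (hab : 1 ≤ a + b) (hcd : 1 ≤ c + d) (hac : 1 ≤ a + c) (hbd : 1 ≤ b + d)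
    (hcb : ¬(c = 0 ∧ b = 0)) (had : ¬(a = 0 ∧ d = 0)) (h₁ : θ₁ < θ₃) (h₂ : θ₂ < θ₃) :
    (1 / 2) * (((a : ℝ) + c - 1) * θ₁ + ((b : ℝ) + d - 1) * θ₂) <
      (1 / (2 * ((a : ℝ) + b))) *
          ((a : ℝ) * (a - 1) * θ₁ + (b : ℝ) * (b - 1) * θ₂ + 2 * a * b * θ₃)
        + (1 / (2 * ((c : ℝ) + d))) *
          ((c : ℝ) * (c - 1) * θ₁ + (d : ℝ) * (d - 1) * θ₂ + 2 * c * d * θ₃) := by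
  have hab' : (0 : ℝ) < a + b := by exact_mod_cast hab
  have hcd' : (0 : ℝ) < c + d := by exact_mod_cast hcd
  have hP := one_le_mul_add_one_div_add_add b d hac
  have hQ := one_le_mul_add_one_div_add_add a c hbd
  rw [add_comm (b : ℝ) a, add_comm (d : ℝ) c] at hQ
  set P : ℝ := a * (b + 1) / (a + b) + c * (d + 1) / (c + d) with hPdef
  set Q : ℝ := b * (a + 1) / (a + b) + d * (c + 1) / (c + d) with hQdef
  have hPQ : 2 < P + Q := by
    have hsum : P + Q = 2 + 2 * (a * b / (a + b) + c * d / (c + d)) := by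
      rw [hPdef, hQdef]
      field_simp
      ring
    have hpos : (0 : ℝ) < a * b / (a + b) + c * d / (c + d) := by
      have hcases : (0 < a ∧ 0 < b) ∨ (0 < c ∧ 0 < d) := by omega
      rcases hcases with ⟨ha, hb⟩ | ⟨hc, hd⟩ <;> positivity
    linarith
  have hpos : 0 < (P - 1) * (θ₃ - θ₁) + (Q - 1) * (θ₃ - θ₂) := by
    rcases hP.lt_or_eq with h | h
    · exact add_pos_of_pos_of_nonneg (mul_pos (sub_pos.2 h) (sub_pos.2 h₁))
        (mul_nonneg (sub_nonneg.2 hQ) (sub_pos.2 h₂).le)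
    · exact add_pos_of_nonneg_of_pos (mul_nonneg (sub_nonneg.2 hP) (sub_pos.2 h₁).le)
        (mul_pos (by linarith) (sub_pos.2 h₂))
  rw [← sub_pos]
  refine (half_pos hpos).trans_eq ?_
  rw [hPdef, hQdef]
  field_simp
  ring

/-- **Key deterministic inequality for Lemma 3(i).**
Comparing the limiting two-cluster within-group criterion of an arbitrary
cluster configuration (placing `k₁` of the first `τ` indices and `k₂` of the
last `n − τ` indices in one cluster of total size `k`) with its value at the
true partition `S_τ = {1,…,τ}`, when within-group squared distances concentrate
at `θ₁` (first group) and `θ₂` (second group) and cross-group squared distances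
concentrate at `θ₃ > max(θ₁, θ₂)`. -/
theorem stmt_9 (n τ k₁ k₂ k : ℕ) (θ₁ θ₂ θ₃ : ℝ)
    (hτ1 : 1 ≤ τ) (hτn : τ ≤ n - 1)
    (hk₁ : k₁ ≤ τ) (hk₂ : k₂ ≤ n - τ)
    (hk : k = k₁ + k₂) (hk1 : 1 ≤ k) (hkn : k ≤ n - 1)
    (hne1 : ¬(k₁ = τ ∧ k₂ = 0)) (hne2 : ¬(k₁ = 0 ∧ k₂ = n - τ))
    (hθ : max θ₁ θ₂ < θ₃) :
    (1 / (2 * (k : ℝ))) *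
        ((k₁ : ℝ) * ((k₁ : ℝ) - 1) * θ₁ + (k₂ : ℝ) * ((k₂ : ℝ) - 1) * θ₂
          + 2 * (k₁ : ℝ) * (k₂ : ℝ) * θ₃)
      + (1 / (2 * ((n : ℝ) - (k : ℝ)))) *
        (((τ : ℝ) - (k₁ : ℝ)) * ((τ : ℝ) - (k₁ : ℝ) - 1) * θ₁
          + ((n : ℝ) - (τ : ℝ) - (k₂ : ℝ)) * ((n : ℝ) - (τ : ℝ) - (k₂ : ℝ) - 1) * θ₂
          + 2 * ((τ : ℝ) - (k₁ : ℝ)) * ((n : ℝ) - (τ : ℝ) - (k₂ : ℝ)) * θ₃)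
      > (1 / 2) * (((τ : ℝ) - 1) * θ₁ + ((n : ℝ) - (τ : ℝ) - 1) * θ₂) := by
  obtain ⟨c, rfl⟩ := Nat.exists_eq_add_of_le hk₁
  obtain ⟨m, rfl⟩ := Nat.exists_eq_add_of_le (show k₁ + c ≤ n by omega)
  obtain ⟨d, rfl⟩ := Nat.exists_eq_add_of_le (show k₂ ≤ m by omega)
  subst hk
  have key := two_cluster_criterion_lt k₁ k₂ c d (by omega) (by omega) (by omega) (by omega)
    (by omega) (by omega) ((le_max_left _ _).trans_lt hθ) ((le_max_right _ _).trans_lt hθ)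
  have hc : ((k₁ + c : ℕ) : ℝ) - k₁ = c := by push_cast; ring
  have hm : ((k₁ + c + (k₂ + d) : ℕ) : ℝ) - (k₁ + c : ℕ) = k₂ + d := by push_cast; ring
  have hn : ((k₁ + c + (k₂ + d) : ℕ) : ℝ) - (k₁ + k₂ : ℕ) = c + d := by push_cast; ring
  rw [hc, hm, hn, add_sub_cancel_left, Nat.cast_add, Nat.cast_add]
  exact key
end

section
/- Let n, k, k₁, τ be integers with 1 ≤ τ ≤ n−1, 2 ≤ k ≤ n−2, 0 ≤ k₁ ≤ τ, and k₁ ≤ k. Then τ/(n−1) < k₁/k + (τ−k₁)/(n−k). -/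
/-- **Key arithmetic inequality for Lemma 3(ii).**
When within-group squared distances concentrate at `θ₁ < θ₂` and cross-group
squared distances concentrate at `(θ₁+θ₂)/2`, every cluster of size `k` with
`2 ≤ k ≤ n−2` has asymptotically larger two-cluster criterion value than a
singleton cluster `{j}` with `j > τ`; the key step is the inequality
`τ/(n−1) < k₁/k + (τ−k₁)/(n−k)`, where `k₁` is the number of indices `≤ τ`
in the cluster. -/
theorem stmt_10 (n k k₁ τ : ℕ)
    (hτ1 : 1 ≤ τ) (hτn : τ ≤ n - 1)
    (hk2 : 2 ≤ k) (hkn : k ≤ n - 2)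
    (hk₁τ : k₁ ≤ τ) (hk₁k : k₁ ≤ k) :
    (τ : ℝ) / ((n : ℝ) - 1) < (k₁ : ℝ) / (k : ℝ) + ((τ : ℝ) - (k₁ : ℝ)) / ((n : ℝ) - (k : ℝ)) := by
  have hkR : (2 : ℝ) ≤ k := by exact_mod_cast hk2
  have hknR : (k : ℝ) + 2 ≤ n := by
    have : k + 2 ≤ n := by omega
    exact_mod_cast this
  have hk₁τR : (k₁ : ℝ) ≤ τ := by exact_mod_cast hk₁τ
  have hsplit : (τ : ℝ) / ((n : ℝ) - 1)
      = (k₁ : ℝ) / ((n : ℝ) - 1) + ((τ : ℝ) - k₁) / ((n : ℝ) - 1) := by ring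
  rw [hsplit]
  rcases Nat.eq_zero_or_pos k₁ with rfl | hpos
  · have hτ : (0 : ℝ) < τ := by exact_mod_cast hτ1
    simpa using div_lt_div_of_pos_left hτ (by linarith : (0 : ℝ) < n - k) (by linarith)
  · have hk₁ : (0 : ℝ) < k₁ := by exact_mod_cast hpos
    exact add_lt_add_of_lt_of_le
      (div_lt_div_of_pos_left hk₁ (by linarith) (by linarith))
      (div_le_div_of_nonneg_left (by linarith) (by linarith) (by linarith))
end

section
/- Let h : [0,∞) → ℝ be concave and strictly increasing. Let θ₁, θ₂, θ₃ ≥ 0 satisfy 2θ₃ > θ₁ + θ₂, and let n, τ be integers with 1 < τ < n−1. Then (n−2)^{-1}·[ (τ−1)·|h(θ₁) − h(θ₃)| + (n−τ−1)·|h(θ₃) − h(θ₂)| ] ≥ (n−2)^{-1}·[ 2h(θ₃) − h(θ₁) − h(θ₂) ] > 0. -/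
/-- **Lower bound on the limiting cross-group dissimilarity `δ̃_{h,ψ,d}`.**
For `h : [0,∞) → ℝ` concave and strictly increasing, `θ₁, θ₂, θ₃ ≥ 0` with
`2θ₃ > θ₁ + θ₂`, and integers `1 < τ < n − 1`,
`(n−2)⁻¹[(τ−1)|h(θ₁) − h(θ₃)| + (n−τ−1)|h(θ₃) − h(θ₂)|]
  ≥ (n−2)⁻¹[2h(θ₃) − h(θ₁) − h(θ₂)] > 0`. -/
theorem stmt_17 (h : ℝ → ℝ)
    (hconc : ConcaveOn ℝ (Set.Ici 0) h) (hmono : StrictMonoOn h (Set.Ici 0))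
    (θ₁ θ₂ θ₃ : ℝ) (h1 : 0 ≤ θ₁) (h2 : 0 ≤ θ₂) (h3 : 0 ≤ θ₃)
    (hsum : θ₁ + θ₂ < 2 * θ₃)
    (n τ : ℕ) (hτ : 1 < τ) (hτn : τ < n - 1) :
    ((n : ℝ) - 2)⁻¹ * (((τ : ℝ) - 1) * |h θ₁ - h θ₃| + ((n : ℝ) - (τ : ℝ) - 1) * |h θ₃ - h θ₂|)
        ≥ ((n : ℝ) - 2)⁻¹ * (2 * h θ₃ - h θ₁ - h θ₂)
      ∧ ((n : ℝ) - 2)⁻¹ * (2 * h θ₃ - h θ₁ - h θ₂) > 0 := by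
  have hτ' : (2 : ℝ) ≤ τ := by exact_mod_cast hτ
  have hn' : (τ : ℝ) + 2 ≤ n := by exact_mod_cast (show τ + 2 ≤ n by omega)
  have hn : 0 < ((n : ℝ) - 2)⁻¹ := inv_pos.2 (by linarith)
  have hmid := hconc.2 (Set.mem_Ici.2 h1) (Set.mem_Ici.2 h2)
    (by norm_num : (0 : ℝ) ≤ 1 / 2) (by norm_num : (0 : ℝ) ≤ 1 / 2) (by norm_num)
  simp only [smul_eq_mul] at hmid
  have hlt : h (1 / 2 * θ₁ + 1 / 2 * θ₂) < h θ₃ :=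
    hmono (Set.mem_Ici.2 (by positivity)) (Set.mem_Ici.2 h3) (by linarith)
  refine ⟨mul_le_mul_of_nonneg_left ?_ hn.le, mul_pos hn (by linarith)⟩
  have hτ_mul : |h θ₁ - h θ₃| ≤ ((τ : ℝ) - 1) * |h θ₁ - h θ₃| :=
    le_mul_of_one_le_left (abs_nonneg _) (by linarith)
  have hn_mul : |h θ₃ - h θ₂| ≤ ((n : ℝ) - τ - 1) * |h θ₃ - h θ₂| :=
    le_mul_of_one_le_left (abs_nonneg _) (by linarith)
  linarith [neg_le_abs (h θ₁ - h θ₃), le_abs_self (h θ₃ - h θ₂)]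
end

section
/- Let n ≥ 2 and 0 < τ < n. Among all C(n,τ) labelings c : {1,…,n} → {0,1} with exactly τ ones, exactly 2 labelings satisfy min_{1 ≤ t ≤ n−1} R(t) = 0 (namely the labeling with all ones first and the labeling with all zeros first). Consequently, if c is chosen uniformly at random among these C(n,τ) labelings, then P( min_{1 ≤ t ≤ n−1} R(t) = 0 ) = 2 / C(n,τ). -/
/-- Disagreement count between the clustering `c : Fin n → Bool` (position `i : Fin n`
is the `(i+1)`-st observation) and the pseudo-clustering `δ_t` with `δ_t = 1` on the
first `t` observations. -/
def randCountF (n : ℕ) (c : Fin n → Bool) (t : ℕ) : ℕ :=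
  ((Finset.univ ×ˢ Finset.univ : Finset (Fin n × Fin n)).filter
    (fun p => p.1 < p.2 ∧ ¬((c p.1 = c p.2) ↔ ((p.1 : ℕ) < t ↔ (p.2 : ℕ) < t)))).card

/-- The Rand index `R(t)`. -/
noncomputable def randIndexF (n : ℕ) (c : Fin n → Bool) (t : ℕ) : ℝ :=
  (randCountF n c t : ℝ) / (n.choose 2 : ℝ)

/-- The Rand index is zero exactly when the two clusterings induce the same partition. -/
theorem randCountF_eq_zero_iff {n : ℕ} {c : Fin n → Bool} {t : ℕ} :
    randCountF n c t = 0 ↔ ∀ i j : Fin n, c i = c j ↔ ((i : ℕ) < t ↔ (j : ℕ) < t) := by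
  simp only [randCountF, Finset.card_eq_zero, Finset.filter_eq_empty_iff, Finset.mem_product,
    Finset.mem_univ, and_self, forall_const, not_and, not_not, Prod.forall]
  constructor
  · intro h i j
    rcases lt_trichotomy i j with hij | rfl | hij
    · exact h i j hij
    · simp
    · exact eq_comm.trans ((h j i hij).trans Iff.comm)
  · intro h i j _
    exact h i j

theorem randCountF_eq_zero_iff_eq {n : ℕ} {c : Fin n → Bool} {t : ℕ} (ht0 : 0 < t) (htn : t < n) :
    randCountF n c t = 0 ↔
      c = (fun i : Fin n => decide ((i : ℕ) < t)) ∨ c = (fun i : Fin n => decide (t ≤ (i : ℕ))) := by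
  rw [randCountF_eq_zero_iff]
  constructor
  · intro h
    have h0 (i : Fin n) : c i = c ⟨0, ht0.trans htn⟩ ↔ (i : ℕ) < t := by
      rw [h]
      simp [ht0]
    cases hc : c ⟨0, ht0.trans htn⟩ with
    | true =>
      left
      funext i
      rw [Bool.eq_iff_iff, decide_eq_true_iff, ← h0 i, hc]
    | false =>
      right
      funext i
      rw [Bool.eq_iff_iff, decide_eq_true_iff, ← not_lt, ← h0 i, hc, Bool.not_eq_false]
  · rintro (rfl | rfl) i j
    · simp
    · simp only [decide_eq_decide]
      omega

theorem randIndexF_nonneg (n : ℕ) (c : Fin n → Bool) (t : ℕ) : 0 ≤ randIndexF n c t := by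
  unfold randIndexF
  positivity

theorem randIndexF_eq_zero_iff {n : ℕ} (hn : 2 ≤ n) {c : Fin n → Bool} {t : ℕ} :
    randIndexF n c t = 0 ↔ randCountF n c t = 0 := by
  have : n.choose 2 ≠ 0 := (Nat.choose_pos hn).ne'
  simp [randIndexF, this]

theorem Finset.inf'_eq_zero_iff_of_nonneg {ι : Type*} {s : Finset ι} (hs : s.Nonempty) {f : ι → ℝ}
    (hf : ∀ i, 0 ≤ f i) : s.inf' hs f = 0 ↔ ∃ i ∈ s, f i = 0 := by
  constructor
  · intro h
    obtain ⟨i, hi, hi'⟩ := s.exists_mem_eq_inf' hs f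
    exact ⟨i, hi, hi'.symm.trans h⟩
  · rintro ⟨i, hi, h⟩
    exact le_antisymm ((Finset.inf'_le f hi).trans_eq h) (Finset.le_inf' hs f fun j _ => hf j)

theorem card_filter_val_lt_of_le {n t : ℕ} (h : t ≤ n) :
    (Finset.univ.filter (fun i : Fin n => (i : ℕ) < t)).card = t := by
  rw [Fin.card_filter_val_lt, min_eq_right h]

theorem card_filter_le_val (n t : ℕ) :
    (Finset.univ.filter (fun i : Fin n => t ≤ (i : ℕ))).card = n - t := by
  have := Finset.card_filter_add_card_filter_not (s := Finset.univ) (fun i : Fin n => (i : ℕ) < t)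
  simp only [not_lt, Fin.card_filter_val_lt, Finset.card_univ, Fintype.card_fin] at this
  omega

/-- The number of binary labelings with exactly `k` ones is a binomial coefficient. -/
theorem card_filter_card_true_eq (n k : ℕ) :
    (Finset.univ.filter (fun c : Fin n → Bool =>
      (Finset.univ.filter (fun i => c i = true)).card = k)).card = n.choose k := by
  trans (Finset.powersetCard k (Finset.univ : Finset (Fin n))).card
  · refine Finset.card_nbij' (fun c => Finset.univ.filter (fun i => c i = true))
      (fun s i => decide (i ∈ s)) ?_ ?_ ?_ ?_
    · intro c hc
      simpa [Finset.mem_powersetCard] using hc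
    · intro s hs
      simpa [Finset.mem_powersetCard] using hs
    · intro c _
      simp
    · intro s _
      simp
  · simp

open scoped Classical in
/-- **Counting labelings with `min_t R(t) = 0`.** Among all `C(n,τ)` labelings with
exactly `τ` ones, exactly two satisfy `min_{1 ≤ t ≤ n−1} R(t) = 0`, namely the
labeling with all ones first and the labeling with all zeros first. Consequently,
under the uniform choice of such a labeling, `P(min_t R(t) = 0) = 2/C(n,τ)`. -/
theorem stmt_19 (n τ : ℕ) (hn : 2 ≤ n) (hτ0 : 0 < τ) (hτn : τ < n)
    (A B : Finset (Fin n → Bool))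
    (hA : A = Finset.univ.filter
      (fun c => (Finset.univ.filter (fun i => c i = true)).card = τ))
    (hB : B = A.filter
      (fun c => (Finset.Icc 1 (n - 1)).inf'
        (Finset.nonempty_Icc.mpr (by omega)) (randIndexF n c) = 0)) :
    B = ({fun i : Fin n => decide ((i : ℕ) < τ), fun i : Fin n => decide (n - τ ≤ (i : ℕ))} :
          Finset (Fin n → Bool))
      ∧ B.card = 2
      ∧ (B.card : ℝ) / (A.card : ℝ) = 2 / (n.choose τ : ℝ) := by
  have hBeq : B = ({fun i : Fin n => decide ((i : ℕ) < τ),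
      fun i : Fin n => decide (n - τ ≤ (i : ℕ))} : Finset (Fin n → Bool)) := by
    ext c
    simp only [hB, hA, Finset.mem_filter, Finset.mem_univ, true_and, Finset.mem_insert,
      Finset.mem_singleton,
      Finset.inf'_eq_zero_iff_of_nonneg _ (randIndexF_nonneg n c), randIndexF_eq_zero_iff hn,
      Finset.mem_Icc]
    constructor
    · rintro ⟨hc, t, ⟨ht1, htn⟩, h⟩
      rcases (randCountF_eq_zero_iff_eq (by omega) (by omega)).1 h with rfl | rfl
      · simp only [decide_eq_true_eq, card_filter_val_lt_of_le (show t ≤ n by omega)] at hc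
        exact Or.inl (by rw [hc])
      · simp only [decide_eq_true_eq, card_filter_le_val] at hc
        exact Or.inr (by rw [show t = n - τ by omega])
    · rintro (rfl | rfl)
      · refine ⟨?_, τ, by omega, (randCountF_eq_zero_iff_eq hτ0 hτn).2 (Or.inl rfl)⟩
        simp only [decide_eq_true_eq, card_filter_val_lt_of_le hτn.le]
      · refine ⟨?_, n - τ, by omega,
          (randCountF_eq_zero_iff_eq (by omega) (by omega)).2 (Or.inr rfl)⟩
        simp only [decide_eq_true_eq, card_filter_le_val]
        omega
  have hBcard : B.card = 2 := by
    rw [hBeq, Finset.card_pair]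
    intro heq
    have := congrFun heq ⟨0, by omega⟩
    simp only [decide_eq_decide] at this
    omega
  refine ⟨hBeq, hBcard, ?_⟩
  rw [hBcard, hA, ← card_filter_card_true_eq n τ]
  norm_num
end
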